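/- Let R be a commutative ring, A an R-algebra, and (A_i)_{i ∈ I} a nonempty directed family (under inclusion) of R-subalgebras of A whose union is A. Let Y be a quasi-compact quasi-separated scheme equipped with a morphism Y ⟶ Spec R which is locally of finite type. Then the canonical map from the colimit over i of the sets of Spec R-morphisms Spec A_i ⟶ Y to the set of Spec R-morphisms Spec A ⟶ Y is bijective. Concretely: every Spec R-morphism Spec A ⟶ Y factors as the canonical map Spec A ⟶ Spec A_i followed by a Spec R-morphism Spec A_i ⟶ Y for some i; and any two Spec R-morphisms Spec A_i ⇉ Y which become equal after composition with Spec A ⟶ Spec A_i already become equal after composition with Spec A_j ⟶ Spec A_i for some j ≥ i. -/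

import Mathlib

open CategoryTheory AlgebraicGeometry

universe u v

lemma RingHom.exists_comp_eq_of_range_le {A B C : Type*} [CommRing A] [CommRing B] [CommRing C]
    {β : B →+* A} {γ : C →+* A} (hγ : Function.Injective γ) (h : β.range ≤ γ.range) :
    ∃ δ : B →+* C, γ.comp δ = β := by
  let e : C ≃+* γ.range :=
    .ofBijective γ.rangeRestrict ⟨fun _ _ h ↦ hγ congr(($h : A)), γ.rangeRestrict_surjective⟩
  refine ⟨(e.symm : γ.range →+* C).comp (β.codRestrict γ.range fun x ↦ h ⟨x, rfl⟩), ?_⟩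
  ext x
  exact congr(($(e.apply_symm_apply ⟨β x, h ⟨x, rfl⟩⟩) : A))

namespace AlgebraicGeometry

open CategoryTheory.Limits TopologicalSpace

lemma Scheme.exists_appTop_eq {X Y : Scheme.{u}} [IsAffine Y] (φ : Γ(Y, ⊤) ⟶ Γ(X, ⊤)) :
    ∃ g : X ⟶ Y, g.appTop = φ :=
  ⟨X.toSpecΓ ≫ Spec.map φ ≫ Y.isoSpec.inv, by
    have h : Y.isoSpec.inv.appTop = (Scheme.ΓSpecIso _).inv := by
      rw [← Category.comp_id (Scheme.ΓSpecIso _).inv, Iso.eq_inv_comp, ← Scheme.toSpecΓ_appTop,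
        ← Scheme.isoSpec_hom, ← Scheme.Hom.comp_appTop, Iso.inv_hom_id, Scheme.Hom.id_appTop]
    rw [Scheme.Hom.comp_appTop, Scheme.Hom.comp_appTop, h, Scheme.toSpecΓ_appTop, Category.assoc,
      Scheme.ΓSpecIso_naturality, Iso.inv_hom_id_assoc]⟩

lemma ext_of_isAffine_of_injective_appTop {W X Y : Scheme.{u}} [IsAffine Y] {h : W ⟶ X}
    (hh : Function.Injective h.appTop) {p q : X ⟶ Y} (e : h ≫ p = h ≫ q) : p = q := by
  refine ext_of_isAffine (CommRingCat.hom_ext (RingHom.ext fun x ↦ hh ?_))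
  have := congr(($e).appTop x)
  rwa [Scheme.Hom.comp_appTop, Scheme.Hom.comp_appTop] at this

variable {I : Type u} [Category.{u} I] {S X : Scheme.{u}} (D : I ⥤ Scheme.{u})
  (t : D ⟶ (Functor.const I).obj S) (f : X ⟶ S) (c : Cone D) (hc : IsLimit c)

include hc in
lemma Scheme.exists_π_app_comp_eq_of_locallyOfFiniteType_of_isAffine
    [IsCofiltered I] [LocallyOfFiniteType f] [IsAffine S] [IsAffine X] [∀ i, IsAffine (D.obj i)]
    (hinj : ∀ i, Function.Injective (c.π.app i).appTop)
    (a : c.pt ⟶ X) (ha : c.π ≫ t = (Functor.const _).map (a ≫ f)) :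
    ∃ (i : I) (g : D.obj i ⟶ X), c.π.app i ≫ g = a ∧ g ≫ f = t.app i := by
  classical
  have ha' (i : I) : c.π.app i ≫ t.app i = a ≫ f := congr(($ha).app i)
  have hft : f.appTop.hom.FiniteType :=
    (HasRingHomProperty.iff_of_isAffine (P := @LocallyOfFiniteType)).mp ‹_›
  algebraize [f.appTop.hom]
  obtain ⟨s, hs⟩ := Algebra.FiniteType.out (R := Γ(S, ⊤)) (A := Γ(X, ⊤))
  choose j y hy using fun x ↦
    exists_appTop_π_eq_of_isAffine_of_isLimit D c hc (a.appTop x)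
  obtain ⟨i, hi⟩ := IsCofiltered.inf_objs_exists (s.image j)
  have hle : a.appTop.hom.range ≤ (c.π.app i).appTop.hom.range := by
    rintro _ ⟨x, rfl⟩
    induction (hs ▸ Algebra.mem_top : x ∈ Algebra.adjoin Γ(S, ⊤) s) using
      Algebra.adjoin_induction with
    | mem x hx =>
      obtain ⟨p⟩ := hi (Finset.mem_image_of_mem j hx)
      refine ⟨(D.map p).appTop (y x), ?_⟩
      have := congr($(c.w p).appTop (y x))
      rw [Scheme.Hom.comp_appTop] at this
      exact this.trans (hy x)
    | algebraMap r =>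
      refine ⟨(t.app i).appTop r, ?_⟩
      have := congr($(ha' i).appTop r)
      rwa [Scheme.Hom.comp_appTop, Scheme.Hom.comp_appTop] at this
    | add x y _ _ hx hy => simpa using add_mem hx hy
    | mul x y _ _ hx hy => simpa using mul_mem hx hy
  obtain ⟨δ, hδ⟩ := RingHom.exists_comp_eq_of_range_le (hinj i) hle
  obtain ⟨g, hg⟩ := Scheme.exists_appTop_eq (Y := X) (X := D.obj i) (CommRingCat.ofHom δ)
  have hga : c.π.app i ≫ g = a := by
    refine ext_of_isAffine ?_
    rw [Scheme.Hom.comp_appTop, hg]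
    exact CommRingCat.hom_ext hδ
  refine ⟨i, g, hga, ext_of_isAffine_of_injective_appTop (hinj i) ?_⟩
  rw [reassoc_of% hga, ha']

lemma Scheme.Hom.injective_resLE_appTop {X Y : Scheme.{u}} (g : X ⟶ Y) {U : Y.Opens} {V : X.Opens}
    (e : V = g ⁻¹ᵁ U) (hg : Function.Injective (g.app U)) :
    Function.Injective (g.resLE U V e.le).appTop := by
  subst e
  have h := Scheme.Hom.resLE_app_top g (U := U) (V := g ⁻¹ᵁ U) le_rfl
  rw [Scheme.Hom.appLE_eq_app] at h
  rw [Scheme.Hom.appTop, h]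
  have h₁ := (ConcreteCategory.bijective_of_isIso U.topIso.hom).1
  have h₂ := (ConcreteCategory.bijective_of_isIso (g ⁻¹ᵁ U).topIso.inv).1
  exact h₂.comp (hg.comp h₁)

lemma Scheme.exists_ι_comp_eq_of_isOpenCover {X Y : Scheme.{u}} {J : Type*} {W : J → X.Opens}
    (hW : IsOpenCover W) (b : ∀ j, (W j : Scheme.{u}) ⟶ Y)
    (hb : ∀ j₁ j₂, X.homOfLE (inf_le_left : W j₁ ⊓ W j₂ ≤ W j₁) ≫ b j₁ =
      X.homOfLE (inf_le_right : W j₁ ⊓ W j₂ ≤ W j₂) ≫ b j₂) :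
    ∃ F : X ⟶ Y, ∀ j, (W j).ι ≫ F = b j := by
  refine ⟨(X.openCoverOfIsOpenCover W hW).glueMorphisms b fun j₁ j₂ ↦ ?_, fun j ↦
    Scheme.Cover.ι_glueMorphisms (X.openCoverOfIsOpenCover W hW) b _ j⟩
  refine (cancel_epi (isPullback_opens_inf (W j₁) (W j₂)).isoPullback.hom).mp ?_
  refine Eq.trans ?_ ((hb j₁ j₂).trans ?_)
  · exact ((isPullback_opens_inf (W j₁) (W j₂)).isoPullback_hom_fst_assoc (b j₁))
  · exact ((isPullback_opens_inf (W j₁) (W j₂)).isoPullback_hom_snd_assoc (b j₂)).symm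

lemma Scheme.hom_ext_of_isOpenCover {X Y : Scheme.{u}} {J : Type*} {W : J → X.Opens}
    (hW : IsOpenCover W) {p q : X ⟶ Y} (h : ∀ j, (W j).ι ≫ p = (W j).ι ≫ q) : p = q :=
  (X.openCoverOfIsOpenCover W hW).hom_ext _ _ h

section

variable [IsCofiltered I] [∀ {i j} (f : i ⟶ j), IsAffineHom (D.map f)] [LocallyOfFiniteType f]

include hc in
lemma Scheme.exists_resLE_comp_eq_of_isAffineOpen [IsAffine S]
    (hinj : ∀ i U, Function.Injective ((c.π.app i).app U))
    (a : c.pt ⟶ X) (ha : c.π ≫ t = (Functor.const _).map (a ≫ f))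
    {i : I} {V : (D.obj i).Opens} (hV : IsAffineOpen V) {W : X.Opens} (hW : IsAffineOpen W)
    (hVW : c.π.app i ⁻¹ᵁ V ≤ a ⁻¹ᵁ W) :
    ∃ (k : I) (h : k ⟶ i) (b : ↑(D.map h ⁻¹ᵁ V) ⟶ X),
      (c.π.app k).resLE (D.map h ⁻¹ᵁ V) (c.π.app i ⁻¹ᵁ V)
        (by rw [← Scheme.Hom.comp_preimage, c.w]) ≫ b = (c.π.app i ⁻¹ᵁ V).ι ≫ a ∧
      b ≫ f = (D.map h ⁻¹ᵁ V).ι ≫ t.app k := by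
  have : IsAffine W := hW
  have (k : Over i) : IsAffine ((opensDiagram D i V).obj k) := hV.preimage (D.map k.hom)
  obtain ⟨k, g, hg, hg'⟩ := exists_π_app_comp_eq_of_locallyOfFiniteType_of_isAffine
    (opensDiagram D i V) (opensDiagramι D i V ≫ (Over.forget i).whiskerLeft t) (W.ι ≫ f)
    (opensCone D c i V) (isLimitOpensCone D c hc i V)
    (fun k ↦ Scheme.Hom.injective_resLE_appTop _
      (by rw [← Scheme.Hom.comp_preimage, c.w]) (hinj _ _)) (a.resLE W _ hVW) <| by
    ext k
    have h₁ := Scheme.Hom.resLE_comp_ι (c.π.app k.left) (U := D.map k.hom ⁻¹ᵁ V)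
      (V := c.π.app i ⁻¹ᵁ V) (by rw [← Scheme.Hom.comp_preimage, c.w])
    have h₂ := Scheme.Hom.resLE_comp_ι a hVW
    have h₃ : c.π.app k.left ≫ t.app k.left = a ≫ f := congr(($ha).app k.left)
    have h₄ := congr($h₁ ≫ t.app k.left)
    rw [Category.assoc, Category.assoc, h₃, ← reassoc_of% h₂] at h₄
    exact h₄
  refine ⟨k.left, k.hom, g ≫ W.ι, ?_, ?_⟩
  · exact (Category.assoc _ _ _).symm.trans
      (congr($hg ≫ W.ι).trans (Scheme.Hom.resLE_comp_ι a hVW))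
  · exact (Category.assoc _ _ _).trans hg'

include hc in
lemma Scheme.exists_resLE_comp_eq_resLE_comp {k : I} {U : (D.obj k).Opens}
    (hU : IsCompact (U : Set (D.obj k))) (p q : (U : Scheme.{u}) ⟶ X)
    (hp : p ≫ f = U.ι ≫ t.app k) (hq : q ≫ f = U.ι ≫ t.app k)
    (hpq : (c.π.app k).resLE U (c.π.app k ⁻¹ᵁ U) le_rfl ≫ p =
      (c.π.app k).resLE U (c.π.app k ⁻¹ᵁ U) le_rfl ≫ q) :
    ∃ (l : I) (h : l ⟶ k), (D.map h).resLE U (D.map h ⁻¹ᵁ U) le_rfl ≫ p =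
      (D.map h).resLE U (D.map h ⁻¹ᵁ U) le_rfl ≫ q := by
  have (x : Over k) : CompactSpace ((opensDiagram D k U).obj x) :=
    isCompact_iff_compactSpace.mp (QuasiCompact.isCompact_preimage (f := D.map x.hom) _ U.isOpen hU)
  have key (r : (U : Scheme.{u}) ⟶ X) (hr : r ≫ f = U.ι ≫ t.app k) :
      (D.map (𝟙 k) ⁻¹ᵁ U).ι ≫ t.app k =
        ((D.map (𝟙 k)).resLE U (D.map (𝟙 k) ⁻¹ᵁ U) le_rfl ≫ r) ≫ f := by
    rw [Category.assoc, hr, Scheme.Hom.resLE_comp_ι_assoc, D.map_id, Category.id_comp]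
  have key' (r : (U : Scheme.{u}) ⟶ X) :
      (c.π.app k).resLE (D.map (𝟙 k) ⁻¹ᵁ U) (c.π.app k ⁻¹ᵁ U)
        (by rw [← Scheme.Hom.comp_preimage, c.w]) ≫
        (D.map (𝟙 k)).resLE U (D.map (𝟙 k) ⁻¹ᵁ U) le_rfl ≫ r =
      (c.π.app k).resLE U (c.π.app k ⁻¹ᵁ U) le_rfl ≫ r := by
    simp only [Scheme.Hom.resLE_comp_resLE_assoc, c.w]
  obtain ⟨l, h, e⟩ := Scheme.exists_hom_comp_eq_comp_of_locallyOfFiniteType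
    (opensDiagram D k U) (opensDiagramι D k U ≫ (Over.forget k).whiskerLeft t) f _
    (isLimitOpensCone D c hc k U) (i := .mk (𝟙 k))
    ((D.map (𝟙 k)).resLE U (D.map (𝟙 k) ⁻¹ᵁ U) le_rfl ≫ p)
    ((D.map (𝟙 k)).resLE U (D.map (𝟙 k) ⁻¹ᵁ U) le_rfl ≫ q)
    (key p hp) (key q hq) ((key' p).trans (hpq.trans (key' q).symm))
  have key'' (r : (U : Scheme.{u}) ⟶ X) : (opensDiagram D k U).map h ≫
      (D.map (𝟙 k)).resLE U (D.map (𝟙 k) ⁻¹ᵁ U) le_rfl ≫ r =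
      (D.map l.hom).resLE U (D.map l.hom ⁻¹ᵁ U) le_rfl ≫ r := by
    have hw : D.map h.left ≫ D.map (𝟙 k) = D.map l.hom := by
      rw [← D.map_comp]; exact congr(D.map $(Over.w h))
    refine (Scheme.Hom.resLE_comp_resLE_assoc ..).trans ?_
    simp only [hw]
  exact ⟨l.left, l.hom, (key'' p).symm.trans (e.trans (key'' q))⟩

include hc in
/-- Given a cofiltered diagram of qcqs schemes `Dᵢ` over an affine scheme `S`, with affine
transition maps and such that the projections `lim Dᵢ ⟶ Dⱼ` are injective on sections, any
`S`-morphism from `lim Dᵢ` to a scheme `X` locally of finite type over `S` factors through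
some `Dⱼ`. -/
theorem Scheme.exists_π_app_comp_eq_of_locallyOfFiniteType_of_injective [IsAffine S]
    [∀ i, CompactSpace (D.obj i)] [∀ i, QuasiSeparatedSpace (D.obj i)]
    (hinj : ∀ i U, Function.Injective ((c.π.app i).app U))
    (a : c.pt ⟶ X) (ha : c.π ≫ t = (Functor.const _).map (a ≫ f)) :
    ∃ (i : I) (g : D.obj i ⟶ X), c.π.app i ≫ g = a ∧ g ≫ f = t.app i := by
  have 𝒰 := c.pt.isBasis_affineOpens.isOpenCover_mem_and_le
    (X.isBasis_affineOpens.isOpenCover.comap a.base.hom)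
  obtain ⟨i, s, V, hV, hV'⟩ := Scheme.exists_isOpenCover_and_isAffine D c hc _ 𝒰 fun U ↦ U.2.1
  choose k₀ h₀ b₀ hb₀ hb₀' using fun j : s ↦
    exists_resLE_comp_eq_of_isAffineOpen D t f c hc hinj a ha (hV' j).1 j.1.1.2.2
      ((hV' j).2.symm.trans_le j.1.2.2)
  obtain ⟨k, hk, hkk, hk'⟩ := IsCofiltered.wideCospan h₀
  have hW (j : s) : D.map hk ⁻¹ᵁ V j = D.map (hkk j) ⁻¹ᵁ D.map (h₀ j) ⁻¹ᵁ V j := by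
    rw [← hk' j, D.map_comp, Scheme.Hom.comp_preimage]
  let W (j : s) : (D.obj k).Opens := D.map hk ⁻¹ᵁ V j
  let b (j : s) : (W j : Scheme.{u}) ⟶ X := (D.map (hkk j)).resLE _ _ (hW j).le ≫ b₀ j
  have hWc (j : s) : IsCompact (W j : Set (D.obj k)) := ((hV' j).1.preimage _).isCompact
  have hbf (j : s) : b j ≫ f = (W j).ι ≫ t.app k := by
    simp only [b, Category.assoc, hb₀', Scheme.Hom.resLE_comp_ι_assoc]
    congr 1
    simp
  have hba (j : s) (U : c.pt.Opens) (hU : U ≤ c.π.app k ⁻¹ᵁ W j) :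
      (c.π.app k).resLE (W j) U hU ≫ b j = U.ι ≫ a := by
    have hU' : U ≤ c.π.app i ⁻¹ᵁ V j := by
      rwa [← c.w hk, Scheme.Hom.comp_preimage]
    have := congr(c.pt.homOfLE hU' ≫ $(hb₀ j))
    rw [Scheme.Hom.map_resLE_assoc, Scheme.homOfLE_ι_assoc] at this
    simp only [b, Scheme.Hom.resLE_comp_resLE_assoc, c.w, this]
  have (x : s × s) : ∃ (l : I) (h : l ⟶ k),
      (D.map h).resLE (W x.1 ⊓ W x.2) _ le_rfl ≫ (D.obj k).homOfLE inf_le_left ≫ b x.1 =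
        (D.map h).resLE (W x.1 ⊓ W x.2) _ le_rfl ≫ (D.obj k).homOfLE inf_le_right ≫ b x.2 := by
    refine exists_resLE_comp_eq_resLE_comp D t f c hc ?_ _ _ (by simp [hbf]) (by simp [hbf]) ?_
    · exact (hWc _).inter_of_isOpen (hWc _) (W _).isOpen (W _).isOpen
    · simp only [Scheme.Hom.resLE_map_assoc, hba]
  choose l₀ f₀ hf₀ using this
  obtain ⟨l, hl, hll, hl'⟩ := IsCofiltered.wideCospan f₀
  have hWl : IsOpenCover fun j ↦ D.map hl ⁻¹ᵁ W j :=
    (hV.comap (D.map hk).base.hom).comap (D.map hl).base.hom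
  obtain ⟨F, hF⟩ := Scheme.exists_ι_comp_eq_of_isOpenCover hWl
    (fun j ↦ (D.map hl).resLE (W j) _ le_rfl ≫ b j) fun j₁ j₂ ↦ by
      have e : D.map hl ⁻¹ᵁ W j₁ ⊓ D.map hl ⁻¹ᵁ W j₂ ≤
          D.map (hll (j₁, j₂)) ⁻¹ᵁ D.map (f₀ (j₁, j₂)) ⁻¹ᵁ (W j₁ ⊓ W j₂) := by
        have h := congr(D.map $(hl' (j₁, j₂)) ⁻¹ᵁ (W j₁ ⊓ W j₂))
        rw [D.map_comp, Scheme.Hom.comp_preimage] at h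
        exact h.ge
      have := congr((D.map (hll (j₁, j₂))).resLE _ _ e ≫ $(hf₀ (j₁, j₂)))
      simpa only [Scheme.Hom.resLE_comp_resLE_assoc, Scheme.Hom.resLE_map_assoc,
        Scheme.Hom.map_resLE_assoc, ← D.map_comp, hl'] using this
  have hFa : c.π.app l ≫ F = a := by
    refine Scheme.hom_ext_of_isOpenCover (hWl.comap (c.π.app l).base.hom) fun j ↦ ?_
    have h₁ := Scheme.Hom.resLE_comp_ι_assoc (c.π.app l) (U := D.map hl ⁻¹ᵁ W j)
      (V := c.π.app l ⁻¹ᵁ D.map hl ⁻¹ᵁ W j) le_rfl F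
    refine h₁.symm.trans ?_
    rw [hF, Scheme.Hom.resLE_comp_resLE_assoc]
    simp only [c.w]
    exact hba j _ _
  refine ⟨l, F, hFa, ext_of_isAffine_of_injective_appTop (hinj l ⊤) ?_⟩
  rw [reassoc_of% hFa]
  exact congr(($ha).app l).symm

end

lemma IsSchemeTheoreticallyDominant.of_injective_appTop {X Y : Scheme.{u}} [IsAffine Y] (f : X ⟶ Y)
    [QuasiCompact f] (hf : Function.Injective f.appTop) : IsSchemeTheoreticallyDominant f :=
  ⟨Scheme.IdealSheafData.ext_of_isAffine
    ((f.ker_apply ⟨⊤, isAffineOpen_top Y⟩).trans <|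
      ((RingHom.injective_iff_ker_eq_bot f.appTop.hom).mp hf).trans (by simp))⟩

lemma Spec.map_app_injective {R S : CommRingCat.{u}} {φ : R ⟶ S} (hφ : Function.Injective φ)
    (U : (Spec R).Opens) : Function.Injective ((Spec.map φ).app U) := by
  have : Function.Injective (Spec.map φ).appTop := by
    have h : (Spec.map φ).appTop =
        (Scheme.ΓSpecIso R).hom ≫ φ ≫ (Scheme.ΓSpecIso S).inv := by
      rw [← Scheme.ΓSpecIso_naturality_assoc, Iso.hom_inv_id, Category.comp_id]
    rw [h]
    exact (ConcreteCategory.bijective_of_isIso (Scheme.ΓSpecIso S).inv).1.comp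
      (hφ.comp (ConcreteCategory.bijective_of_isIso (Scheme.ΓSpecIso R).hom).1)
  have := IsSchemeTheoreticallyDominant.of_injective_appTop _ this
  exact (Spec.map φ).app_injective U

end AlgebraicGeometry

namespace Subalgebra

open CategoryTheory.Limits

variable {R A : Type u} [CommRing R] [CommRing A] [Algebra R A] (s : Set (Subalgebra R A))

/-- The diagram of commutative rings given by a family of subalgebras ordered by inclusion. -/
def toCommRingCat : s ⥤ CommRingCat.{u} where
  obj B := CommRingCat.of B.1
  map h := CommRingCat.ofHom (inclusion (leOfHom h)).toRingHom

/-- The ambient algebra as a cocone over a family of subalgebras. -/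
def toCommRingCatCocone : Cocone (toCommRingCat s) where
  pt := CommRingCat.of A
  ι := { app B := CommRingCat.ofHom B.1.val.toRingHom }

/-- The structure maps from the base ring to a family of subalgebras. -/
def algebraMapToCommRingCat : (Functor.const s).obj (CommRingCat.of R) ⟶ toCommRingCat s where
  app B := CommRingCat.ofHom (algebraMap R B.1)

variable {s}

lemma nonempty_isColimit_toCommRingCatCocone [Nonempty s] [IsDirectedOrder s]
    (h : ∀ a : A, ∃ B ∈ s, a ∈ B) : Nonempty (IsColimit (toCommRingCatCocone s)) := by
  have : ReflectsFilteredColimits (forget CommRingCat.{u}) :=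
    ⟨fun _ ↦ reflectsColimitsOfShape_of_reflectsIsomorphisms⟩
  refine ReflectsColimit.reflects (F := forget _) (Types.FilteredColimit.isColimitOf' _ _ ?_ ?_)
  · intro a
    obtain ⟨B, hB, ha⟩ := h a
    exact ⟨⟨B, hB⟩, ⟨a, ha⟩, rfl⟩
  · exact fun B x y e ↦ ⟨B, 𝟙 B, congr((toCommRingCat s).map (𝟙 B) $(Subtype.ext e))⟩

end Subalgebra

/-- Let `A` be an `R`-algebra which is the union of a nonempty directed family of
`R`-subalgebras `𝒜 i`, and let `Y` be a quasi-compact quasi-separated scheme, locally of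
finite type over `Spec R`.  Then `Hom_{Spec R}(Spec A, Y) = colimᵢ Hom_{Spec R}(Spec (𝒜 i), Y)`:
every `Spec R`-morphism `Spec A ⟶ Y` factors through some `Spec (𝒜 i)`, and two
`Spec R`-morphisms `Spec (𝒜 i) ⇉ Y` agreeing on `Spec A` agree on some `Spec (𝒜 j)`,
`j ≥ i`. -/
theorem hom_spec_union_subalgebras_locallyOfFiniteType
    {R A : Type u} [CommRing R] [CommRing A] [Algebra R A]
    {ι : Type v} [Nonempty ι] (𝒜 : ι → Subalgebra R A)
    (hdir : Directed (· ≤ ·) 𝒜) (hunion : ∀ a : A, ∃ i, a ∈ 𝒜 i)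
    (Y : Scheme.{u}) (g : Y ⟶ Spec (CommRingCat.of R))
    [LocallyOfFiniteType g] [CompactSpace Y] [QuasiSeparatedSpace Y] :
    (∀ φ : Spec (CommRingCat.of A) ⟶ Y,
        φ ≫ g = Spec.map (CommRingCat.ofHom (algebraMap R A)) →
        ∃ (i : ι) (ψ : Spec (CommRingCat.of (𝒜 i)) ⟶ Y),
          ψ ≫ g = Spec.map (CommRingCat.ofHom (algebraMap R (𝒜 i))) ∧
          Spec.map (CommRingCat.ofHom ((𝒜 i).val.toRingHom)) ≫ ψ = φ) ∧
      ∀ (i : ι) (ψ₁ ψ₂ : Spec (CommRingCat.of (𝒜 i)) ⟶ Y),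
        ψ₁ ≫ g = Spec.map (CommRingCat.ofHom (algebraMap R (𝒜 i))) →
        ψ₂ ≫ g = Spec.map (CommRingCat.ofHom (algebraMap R (𝒜 i))) →
        Spec.map (CommRingCat.ofHom ((𝒜 i).val.toRingHom)) ≫ ψ₁ =
          Spec.map (CommRingCat.ofHom ((𝒜 i).val.toRingHom)) ≫ ψ₂ →
        ∃ (j : ι) (hij : 𝒜 i ≤ 𝒜 j),
          Spec.map (CommRingCat.ofHom (Subalgebra.inclusion hij).toRingHom) ≫ ψ₁ =
            Spec.map (CommRingCat.ofHom (Subalgebra.inclusion hij).toRingHom) ≫ ψ₂ := by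
  let s : Set (Subalgebra R A) := Set.range 𝒜
  have : IsDirectedOrder s := ⟨by
    rintro ⟨_, i, rfl⟩ ⟨_, j, rfl⟩
    obtain ⟨k, hik, hjk⟩ := hdir i j
    exact ⟨⟨_, k, rfl⟩, hik, hjk⟩⟩
  have : Nonempty s := (Set.range_nonempty 𝒜).to_subtype
  obtain ⟨hcolim⟩ := Subalgebra.nonempty_isColimit_toCommRingCatCocone (s := s)
    fun a ↦ (hunion a).elim fun i hi ↦ ⟨_, ⟨i, rfl⟩, hi⟩
  let D : sᵒᵖ ⥤ Scheme.{u} := (Subalgebra.toCommRingCat s).op ⋙ Scheme.Spec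
  let c : Limits.Cone D := Scheme.Spec.mapCone (Subalgebra.toCommRingCatCocone s).op
  have hc : Limits.IsLimit c := Limits.isLimitOfPreserves Scheme.Spec hcolim.op
  let t : D ⟶ (Functor.const sᵒᵖ).obj (Spec (CommRingCat.of R)) :=
    { app B := Spec.map ((Subalgebra.algebraMapToCommRingCat s).app B.unop)
      naturality B C h := (Spec.map_comp _ _).symm.trans <|
        congr(Spec.map $(((Subalgebra.algebraMapToCommRingCat s).naturality h.unop).symm)) }
  have (B : sᵒᵖ) : IsAffine (D.obj B) := inferInstanceAs (IsAffine (Spec _))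
  refine ⟨fun φ hφ ↦ ?_, fun i ψ₁ ψ₂ h₁ h₂ h ↦ ?_⟩
  · obtain ⟨⟨_, i, rfl⟩, ψ, hψ, hψ'⟩ :=
      Scheme.exists_π_app_comp_eq_of_locallyOfFiniteType_of_injective D t g c hc
        (fun B ↦ Spec.map_app_injective Subtype.val_injective) φ <| by
        ext B
        exact (Spec.map_comp _ _).symm.trans hφ.symm
    exact ⟨i, ψ, hψ', hψ⟩
  · obtain ⟨⟨_, j, rfl⟩, hij, e⟩ := Scheme.exists_hom_comp_eq_comp_of_locallyOfFiniteType D t g c hc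
      (i := .op ⟨𝒜 i, i, rfl⟩) ψ₁ ψ₂ h₁.symm h₂.symm h
    exact ⟨j, leOfHom hij.unop, e⟩
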